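/- arXiv:2511.11893 — 2 statements merged into one kernel-verified Lean document; each statement's English description precedes it below -/
import Mathlib

section
/- For every integer i, dim_K H^i(C ⊗ K[X]/(X^2), D) = dim_K H^i(C, δ) + β_i. -/
open Polynomial

/-- Dimension of the cohomology `ker g / (im f ∩ ker g)` of a two-step sequence
`M₀ → M₁ → M₂` at the middle spot (when `im f ⊆ ker g` this is `dim ker g / im f`). -/
noncomputable def hDim (K : Type*) [Field K] {M₀ M₁ M₂ : Type*}
    [AddCommGroup M₀] [Module K M₀] [AddCommGroup M₁] [Module K M₁]
    [AddCommGroup M₂] [Module K M₂]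
    (f : M₀ →ₗ[K] M₁) (g : M₁ →ₗ[K] M₂) : ℕ :=
  Module.finrank K
    (↥(LinearMap.ker g) ⧸
      Submodule.comap (LinearMap.ker g).subtype (LinearMap.range f))

/-- The Aomoto Betti number at the middle degree: the dimension of
`ker ĥ / im ĥ` for the maps induced by `h` on cohomology, expressed at the cochain level as
`dim ({z ∈ ker δ₁ : h₁ z ∈ im δ₁} / (h₀(ker δ₀) + im δ₀))`. -/
noncomputable def aomotoDim (K : Type*) [Field K] {M₀ M₁ M₂ : Type*}
    [AddCommGroup M₀] [Module K M₀] [AddCommGroup M₁] [Module K M₁]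
    [AddCommGroup M₂] [Module K M₂]
    (δ₀ : M₀ →ₗ[K] M₁) (δ₁ : M₁ →ₗ[K] M₂)
    (h₀ : M₀ →ₗ[K] M₁) (h₁ : M₁ →ₗ[K] M₂) : ℕ :=
  Module.finrank K
    (↥(LinearMap.ker δ₁ ⊓ Submodule.comap h₁ (LinearMap.range δ₁)) ⧸
      Submodule.comap (LinearMap.ker δ₁ ⊓ Submodule.comap h₁ (LinearMap.range δ₁)).subtype
        (Submodule.map h₀ (LinearMap.ker δ₀) ⊔ LinearMap.range δ₀))

/-- The twisted differential `δ ⊗ id + h ⊗ (a·)` on `M ⊗_K A`. -/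
noncomputable def twD (K : Type*) [CommRing K] {M N A : Type*}
    [AddCommGroup M] [Module K M] [AddCommGroup N] [Module K N]
    [CommRing A] [Algebra K A]
    (δ h : M →ₗ[K] N) (a : A) :
    TensorProduct K M A →ₗ[K] TensorProduct K N A :=
  TensorProduct.map δ (LinearMap.id : A →ₗ[K] A)
    + TensorProduct.map h (LinearMap.mulLeft K a)


section DualNumberBasis

variable {K : Type*} [Field K]

/-- The class of `X` in `K[X]/(X^2)` squares to zero. -/
theorem mk_X_mul_mk_X :
    Ideal.Quotient.mk (Ideal.span {(X : K[X]) ^ 2}) X *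
      Ideal.Quotient.mk (Ideal.span {(X : K[X]) ^ 2}) X = 0 := by
  rw [← map_mul, Ideal.Quotient.eq_zero_iff_mem, ← pow_two]
  exact Ideal.mem_span_singleton_self _

/-- `1` and the class of `X` form a basis of `K[X]/(X^2)`. -/
theorem exists_linearEquiv_quotient_X_sq :
    ∃ e : (K × K) ≃ₗ[K] (K[X] ⧸ Ideal.span {(X : K[X]) ^ 2}),
      e (1, 0) = 1 ∧ e (0, 1) = Ideal.Quotient.mk (Ideal.span {(X : K[X]) ^ 2}) X := by
  let φ : (K × K) →ₗ[K] (K[X] ⧸ Ideal.span {(X : K[X]) ^ 2}) :=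
    (Ideal.Quotient.mkₐ K (Ideal.span {(X : K[X]) ^ 2})).toLinearMap ∘ₗ
      (LinearMap.toSpanSingleton K K[X] 1).coprod (LinearMap.toSpanSingleton K K[X] X)
  have hφ (r s : K) : φ (r, s) = Ideal.Quotient.mk (Ideal.span {(X : K[X]) ^ 2})
      (C r + C s * X) := by
    have : C r + C s * X = r • (1 : K[X]) + s • X := by simp [smul_eq_C_mul]
    rw [this]
    rfl
  have hinj : Function.Injective φ := by
    rw [injective_iff_map_eq_zero]
    rintro ⟨r, s⟩ hrs
    rw [hφ, Ideal.Quotient.eq_zero_iff_mem, Ideal.mem_span_singleton, X_pow_dvd_iff] at hrs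
    have h0 := hrs 0 (by norm_num)
    have h1 := hrs 1 (by norm_num)
    simp at h0
    simp [coeff_C] at h1
    simp [h0, h1]
  have hsurj : Function.Surjective φ := by
    intro y
    obtain ⟨p, rfl⟩ := Ideal.Quotient.mk_surjective y
    refine ⟨(p.coeff 0, p.coeff 1), ?_⟩
    rw [hφ, Ideal.Quotient.eq, Ideal.mem_span_singleton, X_pow_dvd_iff]
    intro d hd
    interval_cases d <;> simp [coeff_C]
  refine ⟨LinearEquiv.ofBijective φ ⟨hinj, hsurj⟩, ?_, ?_⟩
  · exact (hφ 1 0).trans (by simp)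
  · exact (hφ 0 1).trans (by simp)

end DualNumberBasis

section TwistedComplex

open scoped TensorProduct

variable {K : Type*} [Field K] {M N P : Type*}
  [AddCommGroup M] [Module K M] [AddCommGroup N] [Module K N] [AddCommGroup P] [Module K P]

/-- The twisted differential in coordinates: `(a, b) ↦ (δ a, h a + δ b)`. -/
def twistedProd (δ h : M →ₗ[K] N) : M × M →ₗ[K] N × N :=
  (δ.prod h).coprod (LinearMap.inr K N N ∘ₗ δ)

@[simp]
theorem twistedProd_apply (δ h : M →ₗ[K] N) (v : M × M) :
    twistedProd δ h v = (δ v.1, h v.1 + δ v.2) := by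
  simp [twistedProd]

/-- The identification `M × M ≃ M ⊗ A` given by a basis `e` of `A` with two elements. -/
noncomputable def prodTensorEquiv {A : Type*} [AddCommGroup A] [Module K A]
    (e : (K × K) ≃ₗ[K] A) (M : Type*) [AddCommGroup M] [Module K M] :
    (M × M) ≃ₗ[K] TensorProduct K M A :=
  ((TensorProduct.rid K M).symm.prodCongr (TensorProduct.rid K M).symm) ≪≫ₗ
    (TensorProduct.prodRight K K M K K).symm ≪≫ₗ TensorProduct.congr (LinearEquiv.refl K M) e

theorem prodTensorEquiv_apply {A : Type*} [AddCommGroup A] [Module K A]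
    (e : (K × K) ≃ₗ[K] A) (v : M × M) :
    prodTensorEquiv e M v = v.1 ⊗ₜ[K] e (1, 0) + v.2 ⊗ₜ[K] e (0, 1) := by
  have hv : (TensorProduct.prodRight K K M K K).symm (v.1 ⊗ₜ[K] 1, v.2 ⊗ₜ[K] 1) =
      v.1 ⊗ₜ[K] (1, 0) + v.2 ⊗ₜ[K] (0, 1) := by
    rw [LinearEquiv.symm_apply_eq]
    simp
  simp [prodTensorEquiv, hv]

theorem twD_comp_prodTensorEquiv {A : Type*} [CommRing A] [Algebra K A]
    (e : (K × K) ≃ₗ[K] A) {x : A} (he₁ : e (1, 0) = 1) (hex : e (0, 1) = x) (hx : x * x = 0)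
    (δ h : M →ₗ[K] N) :
    twD K δ h x ∘ₗ (prodTensorEquiv e M).toLinearMap =
      (prodTensorEquiv e N).toLinearMap ∘ₗ twistedProd δ h := by
  ext v <;>
    simp [twD, prodTensorEquiv_apply, he₁, hex, hx]

theorem finrank_range_eq_of_comp_linearEquiv {M' N' : Type*} [AddCommGroup M'] [Module K M']
    [AddCommGroup N'] [Module K N'] {f : M →ₗ[K] N} {f' : M' →ₗ[K] N'}
    (e : M ≃ₗ[K] M') (e' : N ≃ₗ[K] N')
    (hf : f' ∘ₗ e.toLinearMap = e'.toLinearMap ∘ₗ f) :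
    Module.finrank K (LinearMap.range f') = Module.finrank K (LinearMap.range f) := by
  rw [← LinearEquiv.finrank_map_eq e' (LinearMap.range f), ← LinearEquiv.range_comp e f', hf,
    LinearMap.range_comp]

theorem finrank_ker_eq_of_comp_linearEquiv {M' N' : Type*} [AddCommGroup M'] [Module K M']
    [AddCommGroup N'] [Module K N'] {f : M →ₗ[K] N} {f' : M' →ₗ[K] N'}
    (e : M ≃ₗ[K] M') (e' : N ≃ₗ[K] N')
    (hf : f' ∘ₗ e.toLinearMap = e'.toLinearMap ∘ₗ f) :
    Module.finrank K (LinearMap.ker f') = Module.finrank K (LinearMap.ker f) := by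
  rw [← LinearEquiv.ker_comp e' f, ← hf, LinearMap.ker_comp,
    Submodule.comap_equiv_eq_map_symm, LinearEquiv.finrank_map_eq]

/-- The dimension of a subspace of a product is the sum of the dimensions of its first
projection and of its intersection with the second factor. -/
theorem Submodule.finrank_map_fst_add_finrank_comap_inr [FiniteDimensional K M]
    [FiniteDimensional K N] (S : Submodule K (M × N)) :
    Module.finrank K (S.map (LinearMap.fst K M N)) +
      Module.finrank K (S.comap (LinearMap.inr K M N)) = Module.finrank K S := by
  rw [← LinearMap.finrank_range_add_finrank_ker ((LinearMap.fst K M N).domRestrict S),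
    LinearMap.range_domRestrict, LinearMap.ker_domRestrict]
  congr 1
  rw [← Submodule.finrank_map_subtype_eq S, Submodule.map_comap_subtype, ← LinearMap.range_inr,
    inf_comm, ← Submodule.map_comap_eq,
    (Submodule.equivMapOfInjective (LinearMap.inr K M N) LinearMap.inr_injective _).finrank_eq]

theorem Submodule.finrank_quotient_comap_subtype_add [FiniteDimensional K M]
    {S T : Submodule K M} (hTS : T ≤ S) :
    Module.finrank K (S ⧸ T.comap S.subtype) + Module.finrank K T = Module.finrank K S := by
  rw [← (Submodule.comapSubtypeEquivOfLe hTS).finrank_eq]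
  exact Submodule.finrank_quotient_add_finrank _

theorem hDim_add_finrank_range [FiniteDimensional K N] {f : M →ₗ[K] N} {g : N →ₗ[K] P}
    (hgf : g ∘ₗ f = 0) :
    hDim K f g + Module.finrank K (LinearMap.range f) = Module.finrank K (LinearMap.ker g) :=
  Submodule.finrank_quotient_comap_subtype_add (LinearMap.range_le_ker_iff.2 hgf)

theorem finrank_ker_twistedProd [FiniteDimensional K M] (δ h : M →ₗ[K] N) :
    Module.finrank K (LinearMap.ker (twistedProd δ h)) =
      Module.finrank K ↥(LinearMap.ker δ ⊓ (LinearMap.range δ).comap h) +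
        Module.finrank K (LinearMap.ker δ) := by
  have hfst : (LinearMap.ker (twistedProd δ h)).map (LinearMap.fst K M M) =
      LinearMap.ker δ ⊓ (LinearMap.range δ).comap h := by
    ext a
    simp only [Submodule.mem_map, LinearMap.mem_ker, twistedProd_apply, Prod.mk_eq_zero,
      LinearMap.fst_apply, Prod.exists, exists_and_right, exists_eq_right, Submodule.mem_inf,
      Submodule.mem_comap, LinearMap.mem_range]
    constructor
    · rintro ⟨b, ha, hb⟩
      exact ⟨ha, -b, by rw [map_neg, eq_comm, ← add_eq_zero_iff_eq_neg, hb]⟩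
    · rintro ⟨ha, b, hb⟩
      exact ⟨-b, ha, by rw [map_neg, hb, add_neg_cancel]⟩
  have hinr : (LinearMap.ker (twistedProd δ h)).comap (LinearMap.inr K M M) =
      LinearMap.ker δ := by
    ext b
    simp
  rw [← Submodule.finrank_map_fst_add_finrank_comap_inr, hfst, hinr]

theorem finrank_range_twistedProd [FiniteDimensional K N] (δ h : M →ₗ[K] N) :
    Module.finrank K (LinearMap.range (twistedProd δ h)) =
      Module.finrank K (LinearMap.range δ) +
        Module.finrank K ↥((LinearMap.ker δ).map h ⊔ LinearMap.range δ) := by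
  have hfst : (LinearMap.range (twistedProd δ h)).map (LinearMap.fst K N N) =
      LinearMap.range δ := by
    ext a
    simp
  have hinr : (LinearMap.range (twistedProd δ h)).comap (LinearMap.inr K N N) =
      (LinearMap.ker δ).map h ⊔ LinearMap.range δ := by
    ext b
    simp [Submodule.mem_sup]
  rw [← Submodule.finrank_map_fst_add_finrank_comap_inr, hfst, hinr]

theorem twistedProd_comp_twistedProd {δ₀ h₀ : M →ₗ[K] N} {δ₁ h₁ : N →ₗ[K] P}
    (hδδ : δ₁ ∘ₗ δ₀ = 0) (hanti : δ₁ ∘ₗ h₀ + h₁ ∘ₗ δ₀ = 0) :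
    twistedProd δ₁ h₁ ∘ₗ twistedProd δ₀ h₀ = 0 := by
  have hδδ' (m : M) : δ₁ (δ₀ m) = 0 := LinearMap.congr_fun hδδ m
  have hanti' (m : M) : δ₁ (h₀ m) + h₁ (δ₀ m) = 0 := LinearMap.congr_fun hanti m
  refine LinearMap.ext fun v => ?_
  simp [hδδ', add_comm (h₁ _), hanti']

theorem hDim_twistedProd [FiniteDimensional K N] {δ₀ h₀ : M →ₗ[K] N} {δ₁ h₁ : N →ₗ[K] P}
    (hδδ : δ₁ ∘ₗ δ₀ = 0) (hhh : h₁ ∘ₗ h₀ = 0) (hanti : δ₁ ∘ₗ h₀ + h₁ ∘ₗ δ₀ = 0) :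
    hDim K (twistedProd δ₀ h₀) (twistedProd δ₁ h₁) =
      hDim K δ₀ δ₁ + aomotoDim K δ₀ δ₁ h₀ h₁ := by
  have hδδ' (m : M) : δ₁ (δ₀ m) = 0 := LinearMap.congr_fun hδδ m
  have hhh' (m : M) : h₁ (h₀ m) = 0 := LinearMap.congr_fun hhh m
  have hanti' (m : M) : δ₁ (h₀ m) + h₁ (δ₀ m) = 0 := LinearMap.congr_fun hanti m
  have hle : (LinearMap.ker δ₀).map h₀ ⊔ LinearMap.range δ₀ ≤
      LinearMap.ker δ₁ ⊓ (LinearMap.range δ₁).comap h₁ := by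
    refine sup_le ?_ ?_
    · rintro _ ⟨m, hm, rfl⟩
      have hm' : δ₀ m = 0 := hm
      have := hanti' m
      rw [hm', map_zero, add_zero] at this
      exact ⟨this, 0, by rw [map_zero, hhh']⟩
    · rintro _ ⟨m, rfl⟩
      exact ⟨hδδ' m, -h₀ m, by rw [map_neg, neg_eq_iff_add_eq_zero, hanti']⟩
  have haom : aomotoDim K δ₀ δ₁ h₀ h₁ + _ = _ :=
    Submodule.finrank_quotient_comap_subtype_add hle
  have htw := hDim_add_finrank_range (twistedProd_comp_twistedProd hδδ hanti)
  have hδ := hDim_add_finrank_range hδδ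
  rw [finrank_ker_twistedProd, finrank_range_twistedProd] at htw
  lia

theorem hDim_twD [FiniteDimensional K N] {A : Type*} [CommRing A] [Algebra K A]
    (e : (K × K) ≃ₗ[K] A) {x : A} (he₁ : e (1, 0) = 1) (hex : e (0, 1) = x) (hx : x * x = 0)
    {δ₀ h₀ : M →ₗ[K] N} {δ₁ h₁ : N →ₗ[K] P}
    (hδδ : δ₁ ∘ₗ δ₀ = 0) (hhh : h₁ ∘ₗ h₀ = 0) (hanti : δ₁ ∘ₗ h₀ + h₁ ∘ₗ δ₀ = 0) :
    hDim K (twD K δ₀ h₀ x) (twD K δ₁ h₁ x) =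
      hDim K δ₀ δ₁ + aomotoDim K δ₀ δ₁ h₀ h₁ := by
  have h₀' := twD_comp_prodTensorEquiv e he₁ hex hx δ₀ h₀
  have h₁' := twD_comp_prodTensorEquiv e he₁ hex hx δ₁ h₁
  have : FiniteDimensional K (N ⊗[K] A) := (prodTensorEquiv e N).finiteDimensional
  have hcomp := twistedProd_comp_twistedProd hδδ hanti
  have htw : twD K δ₁ h₁ x ∘ₗ twD K δ₀ h₀ x = 0 := by
    rw [← LinearMap.cancel_right (prodTensorEquiv e M).surjective, LinearMap.comp_assoc, h₀',
      ← LinearMap.comp_assoc, h₁', LinearMap.comp_assoc, hcomp, LinearMap.comp_zero,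
      LinearMap.zero_comp]
  have := hDim_add_finrank_range htw
  rw [finrank_range_eq_of_comp_linearEquiv _ _ h₀', finrank_ker_eq_of_comp_linearEquiv _ _ h₁',
    ← hDim_add_finrank_range hcomp] at this
  rw [← hDim_twistedProd hδδ hhh hanti]
  exact Nat.add_right_cancel this

end TwistedComplex

/-- For every degree (written `n+1` with `n : ℤ` arbitrary),
`dim_K H^i(C ⊗ K[X]/(X^2), D) = dim_K H^i(C, δ) + β_i`. -/
theorem twisted_cohomology_dim_double
    (K : Type*) [Field K]
    (C : ℤ → Type*) [∀ i, AddCommGroup (C i)] [∀ i, Module K (C i)]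
    [∀ i, FiniteDimensional K (C i)]
    (δ h : ∀ i : ℤ, C i →ₗ[K] C (i + 1))
    (hδδ : ∀ i : ℤ, (δ (i + 1)).comp (δ i) = 0)
    (hhh : ∀ i : ℤ, (h (i + 1)).comp (h i) = 0)
    (hanti : ∀ i : ℤ, (δ (i + 1)).comp (h i) + (h (i + 1)).comp (δ i) = 0)
    (n : ℤ) :
    hDim K
        (twD K (δ n) (h n)
          (Ideal.Quotient.mk (Ideal.span {(X : K[X]) ^ 2}) X))
        (twD K (δ (n + 1)) (h (n + 1))
          (Ideal.Quotient.mk (Ideal.span {(X : K[X]) ^ 2}) X))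
      = hDim K (δ n) (δ (n + 1))
          + aomotoDim K (δ n) (δ (n + 1)) (h n) (h (n + 1)) := by
  obtain ⟨e, he₁, hex⟩ := exists_linearEquiv_quotient_X_sq (K := K)
  exact hDim_twD e he₁ hex mk_X_mul_mk_X (hδδ n) (hhh n) (hanti n)
end

section
/- Let N ≥ 3 be an integer and let i be an integer. Suppose there exist α₁, α₂ ∈ C^i with δα₁ = 0 and δα₂ = h(α₁), such that for every w ∈ C^i with δw = 0, the element h(α₂) − h(w) ∈ C^{i+1} is not a coboundary (i.e., does not lie in the image of δ^i : C^i → C^{i+1}). Then the strict inequality dim_K H^i(C ⊗ K[X]/(X^N), D) < dim_K H^i(C, δ) + (N−1)·β_i holds. -/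
open Polynomial

section Finrank

variable {K M M' : Type*} [Field K] [AddCommGroup M] [Module K M] [AddCommGroup M'] [Module K M']

theorem Submodule.finrank_map_add_finrank_inf_ker [FiniteDimensional K M]
    (f : M →ₗ[K] M') (p : Submodule K M) :
    Module.finrank K (p.map f) + Module.finrank K ↥(p ⊓ LinearMap.ker f) = Module.finrank K p := by
  have h := (f.domRestrict p).finrank_range_add_finrank_ker
  rw [LinearMap.range_domRestrict, LinearMap.ker_domRestrict,
    ← Submodule.finrank_map_subtype_eq, Submodule.map_comap_subtype] at h
  exact h

theorem Submodule.finrank_quotient_comap_subtype_add_finrank_inf [FiniteDimensional K M]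
    (p q : Submodule K M) :
    Module.finrank K (↥p ⧸ q.comap p.subtype) + Module.finrank K ↥(p ⊓ q)
      = Module.finrank K p := by
  rw [← Submodule.finrank_quotient_add_finrank (q.comap p.subtype),
    ← Submodule.map_comap_subtype, Submodule.finrank_map_subtype_eq]

/-- The dimension count behind `im ĥ ≅ ker δ / {z ∈ ker δ : h z ∈ im δ}`. -/
theorem finrank_map_ker_sup_range_add_le [FiniteDimensional K M] [FiniteDimensional K M']
    (δ h : M →ₗ[K] M') :
    Module.finrank K ↥((LinearMap.ker δ).map h ⊔ LinearMap.range δ)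
      + Module.finrank K ↥(LinearMap.ker δ ⊓ (LinearMap.range δ).comap h)
      ≤ Module.finrank K M := by
  set Z := LinearMap.ker δ
  set W := Z ⊓ (LinearMap.range δ).comap h with hW
  have hsup := Submodule.finrank_sup_add_finrank_inf_eq (Z.map h) (LinearMap.range δ)
  have hZ := Submodule.finrank_map_add_finrank_inf_ker h Z
  have hWmap := Submodule.finrank_map_add_finrank_inf_ker h W
  have hδ := δ.finrank_range_add_finrank_ker
  have hker : Module.finrank K ↥(W ⊓ LinearMap.ker h) ≤ Module.finrank K ↥(Z ⊓ LinearMap.ker h) :=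
    Submodule.finrank_mono (inf_le_inf_right _ inf_le_left)
  have hmap : Module.finrank K (W.map h)
      ≤ Module.finrank K ↥(Z.map h ⊓ LinearMap.range δ) := by
    refine Submodule.finrank_mono (le_inf (Submodule.map_mono inf_le_left) ?_)
    exact Submodule.map_le_iff_le_comap.2 inf_le_right
  change _ + Module.finrank K Z = _ at hδ
  omega

end Finrank

section TwistedCocycles

variable {K M M' : Type*} [Field K] [AddCommGroup M] [Module K M] [AddCommGroup M'] [Module K M']

/-- The coefficient sequences `(c₀, …, c_{N-1})` of cocycles of `δ + h X` modulo `X ^ N`. -/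
def twistedCocycles (δ h : M →ₗ[K] M') (N : ℕ) : Submodule K (Fin N → M) where
  carrier := {c | (∀ k : Fin N, k.val = 0 → δ (c k) = 0) ∧
    ∀ j k : Fin N, j.val + 1 = k.val → δ (c k) + h (c j) = 0}
  add_mem' := by
    rintro a b ⟨ha, ha'⟩ ⟨hb, hb'⟩
    refine ⟨fun k hk => by simp [ha k hk, hb k hk], fun j k hjk => ?_⟩
    have := congrArg₂ (· + ·) (ha' j k hjk) (hb' j k hjk)
    simp only [Pi.add_apply, map_add, add_zero] at this ⊢
    rw [← this]
    abel
  zero_mem' := by simp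
  smul_mem' := by
    rintro r a ⟨ha, ha'⟩
    refine ⟨fun k hk => by simp [ha k hk], fun j k hjk => ?_⟩
    simp [← smul_add, ha' j k hjk]

theorem mem_twistedCocycles {δ h : M →ₗ[K] M'} {N : ℕ} {c : Fin N → M} :
    c ∈ twistedCocycles δ h N ↔ (∀ k : Fin N, k.val = 0 → δ (c k) = 0) ∧
      ∀ j k : Fin N, j.val + 1 = k.val → δ (c k) + h (c j) = 0 :=
  Iff.rfl

theorem finrank_twistedCocycles_succ_le [FiniteDimensional K M] (δ h : M →ₗ[K] M') (N : ℕ) :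
    Module.finrank K (twistedCocycles δ h (N + 1)) ≤ Module.finrank K (twistedCocycles δ h N)
      + Module.finrank K ((twistedCocycles δ h (N + 1)).map (LinearMap.proj 0 : _ →ₗ[K] M)) := by
  rw [← Submodule.finrank_map_add_finrank_inf_ker (LinearMap.proj 0 : _ →ₗ[K] M)
    (twistedCocycles δ h (N + 1)), add_comm]
  refine Nat.add_le_add_right ?_ _
  have hmem : ∀ c ∈ twistedCocycles δ h (N + 1) ⊓ LinearMap.ker (LinearMap.proj 0 : _ →ₗ[K] M),
      LinearMap.funLeft K M Fin.succ c ∈ twistedCocycles δ h N := by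
    rintro c ⟨⟨-, hc⟩, hc0⟩
    have hc0 : c 0 = 0 := hc0
    refine ⟨fun k hk => ?_, fun j k hjk => hc j.succ k.succ (by simp [hjk])⟩
    simpa [hc0] using hc 0 k.succ (by simp [hk])
  refine LinearMap.finrank_le_finrank_of_injective
    (f := (LinearMap.funLeft K M Fin.succ).restrict hmem) ?_
  rintro ⟨a, _, ha⟩ ⟨b, _, hb⟩ hab
  have ha : a 0 = 0 := ha
  have hb : b 0 = 0 := hb
  refine Subtype.ext (funext (Fin.cases (ha.trans hb.symm) fun k => ?_))
  exact congrFun (congrArg Subtype.val hab) k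

theorem map_proj_zero_twistedCocycles_le (δ h : M →ₗ[K] M') (N : ℕ) :
    (twistedCocycles δ h (N + 1)).map (LinearMap.proj 0 : _ →ₗ[K] M) ≤ LinearMap.ker δ := by
  rintro _ ⟨c, hc, rfl⟩
  exact hc.1 0 rfl

theorem map_proj_zero_twistedCocycles_le_inf (δ h : M →ₗ[K] M') (N : ℕ) :
    (twistedCocycles δ h (N + 2)).map (LinearMap.proj 0 : _ →ₗ[K] M)
      ≤ LinearMap.ker δ ⊓ (LinearMap.range δ).comap h := by
  rintro _ ⟨c, hc, rfl⟩
  refine ⟨hc.1 0 rfl, -c 1, ?_⟩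
  rw [map_neg]
  exact neg_eq_of_add_eq_zero_right (hc.2 0 1 (by simp))

theorem finrank_twistedCocycles_le [FiniteDimensional K M] (δ h : M →ₗ[K] M') (N : ℕ) :
    Module.finrank K (twistedCocycles δ h (N + 1)) ≤ Module.finrank K (LinearMap.ker δ)
      + N * Module.finrank K ↥(LinearMap.ker δ ⊓ (LinearMap.range δ).comap h) := by
  induction N with
  | zero =>
    have h0 : Module.finrank K (twistedCocycles δ h 0) = 0 := Module.finrank_zero_of_subsingleton
    have h1 := finrank_twistedCocycles_succ_le δ h 0
    have h2 := Submodule.finrank_mono (map_proj_zero_twistedCocycles_le δ h 0)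
    omega
  | succ N ih =>
    have h1 := finrank_twistedCocycles_succ_le δ h (N + 1)
    have h2 := Submodule.finrank_mono (map_proj_zero_twistedCocycles_le_inf δ h N)
    rw [add_one_mul, ← add_assoc]
    exact h1.trans (Nat.add_le_add ih h2)

theorem finrank_twistedCocycles_lt_of_massey [FiniteDimensional K M] (δ h : M →ₗ[K] M') (N : ℕ) {α₁ α₂ : M}
    (hα₁ : δ α₁ = 0) (hα₂ : δ α₂ = h α₁)
    (hmassey : ∀ w, δ w = 0 → h α₂ - h w ∉ LinearMap.range δ) :
    Module.finrank K (twistedCocycles δ h (N + 3)) < Module.finrank K (LinearMap.ker δ)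
      + (N + 2) * Module.finrank K ↥(LinearMap.ker δ ⊓ (LinearMap.range δ).comap h) := by
  have h1 := finrank_twistedCocycles_succ_le δ h (N + 2)
  have h2 := finrank_twistedCocycles_le δ h (N + 1)
  have h3 : (twistedCocycles δ h (N + 3)).map (LinearMap.proj 0 : _ →ₗ[K] M)
      < LinearMap.ker δ ⊓ (LinearMap.range δ).comap h := by
    refine lt_of_le_of_ne (map_proj_zero_twistedCocycles_le_inf δ h (N + 1)) fun heq => ?_
    have hmem : α₁ ∈ LinearMap.ker δ ⊓ (LinearMap.range δ).comap h := ⟨hα₁, α₂, hα₂⟩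
    rw [← heq] at hmem
    obtain ⟨c, ⟨-, hc⟩, hc0⟩ := hmem
    have hc0 : c 0 = α₁ := hc0
    have h01 := hc 0 1 (by simp)
    have h12 := hc 1 2 (Nat.mod_eq_of_lt (by omega : 2 < N + 3)).symm
    refine hmassey (α₂ + c 1) ?_ ⟨c 2, ?_⟩
    · rw [map_add, hα₂, add_comm, ← hc0, h01]
    · rw [map_add, sub_add_cancel_left]
      exact eq_neg_of_add_eq_zero_left h12
  have h4 := Submodule.finrank_lt_finrank_of_lt h3
  rw [show N + 2 = N + 1 + 1 from rfl, add_one_mul, ← add_assoc]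
  exact h1.trans_lt (Nat.add_lt_add_of_le_of_lt h2 h4)

end TwistedCocycles

section TensorModel

variable {K M M' A : Type*} [Field K] [AddCommGroup M] [Module K M]
  [AddCommGroup M'] [Module K M'] [CommRing A] [Algebra K A]

theorem twD_tmul (δ h : M →ₗ[K] M') (a : A) (m : M) (x : A) :
    twD K δ h a (m ⊗ₜ x) = δ m ⊗ₜ x + h m ⊗ₜ (a * x) := by
  simp [twD]

theorem twD_comp_twD {M'' : Type*} [AddCommGroup M''] [Module K M'']
    {δ h : M →ₗ[K] M'} {δ' h' : M' →ₗ[K] M''} (a : A)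
    (hδδ : δ'.comp δ = 0) (hhh : h'.comp h = 0) (hanti : δ'.comp h + h'.comp δ = 0) :
    (twD K δ' h' a).comp (twD K δ h a) = 0 := by
  refine TensorProduct.ext' fun m x => ?_
  have h1 : δ' (δ m) = 0 := LinearMap.congr_fun hδδ m
  have h2 : h' (h m) = 0 := LinearMap.congr_fun hhh m
  have h3 : δ' (h m) + h' (δ m) = 0 := LinearMap.congr_fun hanti m
  simp [twD_tmul, h1, h2, ← TensorProduct.add_tmul, add_comm (h' _), h3]

/-- The coefficients of an element of `M ⊗ A` with respect to a finite basis of `A`. -/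
noncomputable def tensorCoeff (M : Type*) [AddCommGroup M] [Module K M] {ι : Type*} [Finite ι]
    (b : Module.Basis ι K A) : TensorProduct K M A ≃ₗ[K] (ι → M) :=
  open Classical in
  TensorProduct.equivFinsuppOfBasisRight b ≪≫ₗ Finsupp.linearEquivFunOnFinite K M ι

theorem tensorCoeff_tmul {ι : Type*} [Finite ι] (b : Module.Basis ι K A) (m : M) (x : A) (k : ι) :
    tensorCoeff M b (m ⊗ₜ x) k = b.repr x k • m := by
  classical
  simp [tensorCoeff]

section PowerBasis

variable {N : ℕ} {a : A} (b : Module.Basis (Fin N) K A) (hb : ∀ j, b j = a ^ j.val)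
  (ha : a ^ N = 0)

include hb ha

theorem mul_basis_apply_eq (i : Fin N) :
    a * b i = if hi : i.val + 1 < N then b ⟨i.val + 1, hi⟩ else 0 := by
  rw [hb, ← pow_succ']
  split_ifs with hi
  · rw [hb]
  · rw [show i.val + 1 = N by omega, ha]

theorem repr_mul_eq_zero (x : A) {k : Fin N} (hk : k.val = 0) : b.repr (a * x) k = 0 := by
  suffices h : b.coord k ∘ₗ LinearMap.mulLeft K a = 0 from LinearMap.congr_fun h x
  refine b.ext fun i => ?_
  have key := mul_basis_apply_eq b hb ha i
  split_ifs at key with hi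
  · simp [key, Fin.ext_iff, hk]
  · simp [key]

theorem repr_mul_succ (x : A) {j k : Fin N} (hjk : j.val + 1 = k.val) :
    b.repr (a * x) k = b.repr x j := by
  suffices h : b.coord k ∘ₗ LinearMap.mulLeft K a = b.coord j from LinearMap.congr_fun h x
  refine b.ext fun i => ?_
  have key := mul_basis_apply_eq b hb ha i
  split_ifs at key with hi
  · simp [key, Finsupp.single_apply, Fin.ext_iff, ← hjk]
  · have hij : i ≠ j := by
      rintro rfl
      exact hi (hjk ▸ k.isLt)
    simp [key, hij]

/-- Taking coefficients embeds the kernel of the twisted differential into `twistedCocycles`. -/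
theorem finrank_ker_twD_le [FiniteDimensional K M] (δ h : M →ₗ[K] M') :
    Module.finrank K (LinearMap.ker (twD K δ h a))
      ≤ Module.finrank K (twistedCocycles δ h N) := by
  have hmem : ∀ t ∈ LinearMap.ker (twD K δ h a),
      (tensorCoeff M b).toLinearMap t ∈ twistedCocycles δ h N := by
    intro t ht
    rw [LinearMap.mem_ker] at ht
    refine ⟨fun k hk => ?_, fun j k hjk => ?_⟩
    · have hcoeff : LinearMap.proj k ∘ₗ (tensorCoeff M' b).toLinearMap ∘ₗ twD K δ h a
          = δ ∘ₗ LinearMap.proj k ∘ₗ (tensorCoeff M b).toLinearMap :=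
        TensorProduct.ext' fun m x => by
          simp [twD_tmul, tensorCoeff_tmul, repr_mul_eq_zero b hb ha x hk]
      simpa [ht] using (LinearMap.congr_fun hcoeff t).symm
    · have hcoeff : LinearMap.proj k ∘ₗ (tensorCoeff M' b).toLinearMap ∘ₗ twD K δ h a
          = δ ∘ₗ LinearMap.proj k ∘ₗ (tensorCoeff M b).toLinearMap
            + h ∘ₗ LinearMap.proj j ∘ₗ (tensorCoeff M b).toLinearMap :=
        TensorProduct.ext' fun m x => by
          simp [twD_tmul, tensorCoeff_tmul, repr_mul_succ b hb ha x hjk]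
      simpa [ht] using (LinearMap.congr_fun hcoeff t).symm
  exact LinearMap.finrank_le_finrank_of_injective
    (f := (tensorCoeff M b).toLinearMap.restrict hmem) fun s t hst =>
      Subtype.ext ((tensorCoeff M b).injective (congrArg Subtype.val hst))

end PowerBasis

theorem exists_basis_quotient_span_X_pow (K : Type*) [Field K] (N : ℕ) :
    ∃ b : Module.Basis (Fin N) K (K[X] ⧸ Ideal.span {(X : K[X]) ^ N}),
      ∀ j, b j = Ideal.Quotient.mk (Ideal.span {(X : K[X]) ^ N}) X ^ j.val := by
  let pb := AdjoinRoot.powerBasis' (monic_X_pow (R := K) N)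
  have hdim : pb.dim = N := natDegree_X_pow N
  exact ⟨pb.basis.reindex (finCongr hdim), fun j =>
    (pb.basis.reindex_apply (finCongr hdim) j).trans (pb.basis_eq_pow _)⟩

end TensorModel

/-- if `N ≥ 3` and there is a Massey chain `α₁, α₂` in degree `i = n+1`
(`δα₁ = 0`, `δα₂ = h(α₁)`) whose triple Massey product `h(α₂)` is not a coboundary even
after modification by `h(w)` for any cocycle `w` (non-triviality modulo the indeterminacy),
then `dim_K H^i(C ⊗ K[X]/(X^N), D) < dim_K H^i(C, δ) + (N−1)·β_i`. -/
theorem twisted_cohomology_dim_lt_of_massey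
    (K : Type*) [Field K]
    (C : ℤ → Type*) [∀ i, AddCommGroup (C i)] [∀ i, Module K (C i)]
    [∀ i, FiniteDimensional K (C i)]
    (δ h : ∀ i : ℤ, C i →ₗ[K] C (i + 1))
    (hδδ : ∀ i : ℤ, (δ (i + 1)).comp (δ i) = 0)
    (hhh : ∀ i : ℤ, (h (i + 1)).comp (h i) = 0)
    (hanti : ∀ i : ℤ, (δ (i + 1)).comp (h i) + (h (i + 1)).comp (δ i) = 0)
    (N : ℕ) (hN : 3 ≤ N) (n : ℤ)
    (α₁ α₂ : C (n + 1))
    (hα₁ : δ (n + 1) α₁ = 0)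
    (hα₂ : δ (n + 1) α₂ = h (n + 1) α₁)
    (hmassey : ∀ w : C (n + 1), δ (n + 1) w = 0 →
      h (n + 1) α₂ - h (n + 1) w ∉ LinearMap.range (δ (n + 1))) :
    hDim K
        (twD K (δ n) (h n)
          (Ideal.Quotient.mk (Ideal.span {(X : K[X]) ^ N}) X))
        (twD K (δ (n + 1)) (h (n + 1))
          (Ideal.Quotient.mk (Ideal.span {(X : K[X]) ^ N}) X))
      < hDim K (δ n) (δ (n + 1))
          + (N - 1) * aomotoDim K (δ n) (δ (n + 1)) (h n) (h (n + 1)) := by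
  obtain ⟨N, rfl⟩ := Nat.exists_eq_add_of_le' hN
  obtain ⟨b, hb⟩ := exists_basis_quotient_span_X_pow K (N + 3)
  set a := Ideal.Quotient.mk (Ideal.span {(X : K[X]) ^ (N + 3)}) X
  have ha : a ^ (N + 3) = 0 := by
    rw [← map_pow, Ideal.Quotient.eq_zero_iff_mem]
    exact Ideal.mem_span_singleton_self _
  have : FiniteDimensional K (K[X] ⧸ Ideal.span {(X : K[X]) ^ (N + 3)}) :=
    b.finiteDimensional_of_finite
  have hker := (finrank_ker_twD_le b hb ha (δ (n + 1)) (h (n + 1))).trans_lt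
    (finrank_twistedCocycles_lt_of_massey _ _ N hα₁ hα₂ hmassey)
  have hker' := (finrank_ker_twD_le b hb ha (δ n) (h n)).trans
    (finrank_twistedCocycles_le _ _ (N + 2))
  have hrank' := (twD K (δ n) (h n) a).finrank_range_add_finrank_ker
  rw [Module.finrank_tensorProduct, Module.finrank_eq_card_basis b, Fintype.card_fin,
    mul_comm] at hrank'
  have hsplit : (N + 3) * Module.finrank K (C n)
      = (N + 2) * Module.finrank K (C n) + Module.finrank K (C n) := add_one_mul (N + 2) _
  have hrank := (δ n).finrank_range_add_finrank_ker
  have hle : LinearMap.range (twD K (δ n) (h n) a)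
      ≤ LinearMap.ker (twD K (δ (n + 1)) (h (n + 1)) a) :=
    LinearMap.range_le_ker_iff.2 (twD_comp_twD a (hδδ n) (hhh n) (hanti n))
  have htw := Submodule.finrank_quotient_comap_subtype_add_finrank_inf
    (LinearMap.ker (twD K (δ (n + 1)) (h (n + 1)) a)) (LinearMap.range (twD K (δ n) (h n) a))
  rw [inf_eq_right.2 hle] at htw
  have hH := Submodule.finrank_quotient_comap_subtype_add_finrank_inf
    (LinearMap.ker (δ (n + 1))) (LinearMap.range (δ n))
  have hHle : Module.finrank K ↥(LinearMap.ker (δ (n + 1)) ⊓ LinearMap.range (δ n))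
      ≤ Module.finrank K (LinearMap.range (δ n)) := Submodule.finrank_mono inf_le_right
  have hβ := Submodule.finrank_quotient_comap_subtype_add_finrank_inf
    (LinearMap.ker (δ (n + 1)) ⊓ (LinearMap.range (δ (n + 1))).comap (h (n + 1)))
    ((LinearMap.ker (δ n)).map (h n) ⊔ LinearMap.range (δ n))
  have hβle : Module.finrank K
        ↥((LinearMap.ker (δ (n + 1)) ⊓ (LinearMap.range (δ (n + 1))).comap (h (n + 1)))
          ⊓ ((LinearMap.ker (δ n)).map (h n) ⊔ LinearMap.range (δ n)))
      ≤ Module.finrank K ↥((LinearMap.ker (δ n)).map (h n) ⊔ LinearMap.range (δ n)) :=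
    Submodule.finrank_mono inf_le_right
  have hB := finrank_map_ker_sup_range_add_le (δ n) (h n)
  have hmul := Nat.mul_le_mul_left (N + 2) (hβ.symm.le.trans (Nat.add_le_add_left hβle _))
  have hmul' := Nat.mul_le_mul_left (N + 2) hB
  rw [hDim, hDim, aomotoDim, show N + 3 - 1 = N + 2 from rfl]
  rw [mul_add] at hmul hmul'
  omega
end
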